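/- arXiv:1810.09355 — 3 statements merged into one kernel-verified Lean document; each statement's English description precedes it below -/
import Mathlib

section
/- Let D be a graph database over Σ, 𝔾 a basic graph pattern, and S the largest dual simulation between G(𝔾) and D. For every database node o ∈ O_D such that there exist a variable v ∈ vars(𝔾) and a match μ ∈ ⟦𝔾⟧_D with μ(v) = o, it holds that (v, o) ∈ S. -/
/-- A relation `S ⊆ V₁ × V₂` is a dual simulation between the edge-labeled directed
graphs `(V₁, E₁)` and `(V₂, E₂)` over the same label alphabet `L`. -/
def DualSim {V₁ V₂ L : Type*} (E₁ : Set (V₁ × L × V₁)) (E₂ : Set (V₂ × L × V₂))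
    (S : Set (V₁ × V₂)) : Prop :=
  ∀ v₁ v₂, (v₁, v₂) ∈ S →
    (∀ a w₁, (v₁, a, w₁) ∈ E₁ → ∃ w₂, (v₂, a, w₂) ∈ E₂ ∧ (w₁, w₂) ∈ S) ∧
    (∀ a u₁, (u₁, a, v₁) ∈ E₁ → ∃ u₂, (u₂, a, v₂) ∈ E₂ ∧ (u₁, u₂) ∈ S)

/-- The set of variables occurring in the triple patterns of a basic graph pattern. -/
def varsOf {𝒱 L : Type*} (G : Set (𝒱 × L × 𝒱)) : Set 𝒱 :=
  {v | ∃ a w, (v, a, w) ∈ G ∨ (w, a, v) ∈ G}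

/-- `μ` (a partial function, encoded via `Option`) is a match for the basic graph
pattern `G` in the graph database with edge relation `ED`: its domain is exactly
`varsOf G` and every triple pattern of `G` is realized as an edge of the database. -/
def IsMatch {𝒱 O L : Type*} (ED : Set (O × L × O)) (G : Set (𝒱 × L × 𝒱))
    (μ : 𝒱 → Option O) : Prop :=
  (∀ v, (∃ o, μ v = some o) ↔ v ∈ varsOf G) ∧
  ∀ v a w, (v, a, w) ∈ G → ∃ o o', μ v = some o ∧ μ w = some o' ∧ (o, a, o') ∈ ED

/-- The match `μ` viewed as a relation `{(v, μ(v)) | v ∈ dom(μ)}`. -/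
def matchRel {𝒱 O : Type*} (μ : 𝒱 → Option O) : Set (𝒱 × O) :=
  {p | μ p.1 = some p.2}

/-- Two partial functions are compatible iff they agree on their common domain. -/
def Compatible {𝒱 O : Type*} (μ₁ μ₂ : 𝒱 → Option O) : Prop :=
  ∀ v o₁ o₂, μ₁ v = some o₁ → μ₂ v = some o₂ → o₁ = o₂

/-- Union of two partial functions (left-biased; on compatible ones this is the union). -/
def munion {𝒱 O : Type*} (μ₁ μ₂ : 𝒱 → Option O) : 𝒱 → Option O :=
  fun v => (μ₁ v).orElse (fun _ => μ₂ v)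

/-- Restriction of a partial function to a set of variables. -/
noncomputable def restrictDom {𝒱 O : Type*} (μ : 𝒱 → Option O) (A : Set 𝒱) :
    𝒱 → Option O :=
  fun v => letI := Classical.dec (v ∈ A); if v ∈ A then μ v else none

/-- SPARQL conjunction (AND) semantics: compatible unions of matches. -/
def AndSem {𝒱 O L : Type*} (ED : Set (O × L × O)) (G₁ G₂ : Set (𝒱 × L × 𝒱)) :
    Set (𝒱 → Option O) :=
  {μ | ∃ μ₁ μ₂, IsMatch ED G₁ μ₁ ∧ IsMatch ED G₂ μ₂ ∧ Compatible μ₁ μ₂ ∧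
    μ = munion μ₁ μ₂}

/-- SPARQL optional (OPT) semantics: left-outer join. -/
def OptSem {𝒱 O L : Type*} (ED : Set (O × L × O)) (G₁ G₂ : Set (𝒱 × L × 𝒱)) :
    Set (𝒱 → Option O) :=
  AndSem ED G₁ G₂ ∪
    {μ | IsMatch ED G₁ μ ∧ ∀ μ', IsMatch ED G₂ μ' → ¬ Compatible μ μ'}

/-- The relation induced by a match is a dual simulation between pattern and database. -/
theorem IsMatch.dualSim_matchRel {𝒱 O L : Type*} {ED : Set (O × L × O)}
    {G : Set (𝒱 × L × 𝒱)} {μ : 𝒱 → Option O} (hμ : IsMatch ED G μ) :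
    DualSim G ED (matchRel μ) := by
  intro v o hvo
  replace hvo : μ v = some o := hvo
  refine ⟨fun a w hw => ?_, fun a u hu => ?_⟩
  · obtain ⟨o₁, o₂, h₁, h₂, he⟩ := hμ.2 v a w hw
    obtain rfl : o₁ = o := Option.some.inj (h₁.symm.trans hvo)
    exact ⟨o₂, he, h₂⟩
  · obtain ⟨o₁, o₂, h₁, h₂, he⟩ := hμ.2 u a v hu
    obtain rfl : o₂ = o := Option.some.inj (h₂.symm.trans hvo)
    exact ⟨o₁, he, h₁⟩

/-- Soundness for BGPs: every node assigned to a variable by some match belongs to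
the largest dual simulation between the pattern graph and the database. -/
theorem bgp_soundness {𝒱 O L : Type*} (ED : Set (O × L × O))
    (G : Set (𝒱 × L × 𝒱)) (hG : G.Finite) (S : Set (𝒱 × O))
    (hS : DualSim G ED S) (hmax : ∀ S', DualSim G ED S' → S' ⊆ S)
    (o : O) (v : 𝒱) (hv : v ∈ varsOf G) (μ : 𝒱 → Option O)
    (hμ : IsMatch ED G μ) (hvo : μ v = some o) :
    (v, o) ∈ S :=
  hmax _ hμ.dualSim_matchRel hvo
end

section
/- The converse of BGP soundness fails: let Σ = {k}, let P be the graph with node set {x, y} and edge set {(x, k, y), (y, k, x)}, and let K be the graph with node set {p₁, p₂, p₃, p₄} and edge set {(p₁, k, p₂), (p₂, k, p₁), (p₂, k, p₃), (p₃, k, p₂), (p₃, k, p₄), (p₄, k, p₁)}. Then the full relation {x, y} × {p₁, p₂, p₃, p₄} is a dual simulation between P and K (hence (x, p₄) belongs to the largest dual simulation between P and K), but there is no function μ : {x, y} → {p₁, p₂, p₃, p₄} with (μ(x), k, μ(y)) and (μ(y), k, μ(x)) both edges of K that maps x or y to p₄. -/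
/-- Pattern graph `P`: nodes `x = 0`, `y = 1` (of `Fin 2`), single label `k = ()`,
edges `(x, k, y)` and `(y, k, x)`. -/
def EP : Set (Fin 2 × Unit × Fin 2) :=
  {(0, (), 1), (1, (), 0)}

/-- Database graph `K`: nodes `p₁ = 0, p₂ = 1, p₃ = 2, p₄ = 3` (of `Fin 4`),
edges as in the counterexample (mutual `k`-edges `p₁↔p₂`, `p₂↔p₃`, plus
`(p₃, k, p₄)` and `(p₄, k, p₁)`). -/
def EK : Set (Fin 4 × Unit × Fin 4) :=
  {(0, (), 1), (1, (), 0), (1, (), 2), (2, (), 1), (2, (), 3), (3, (), 0)}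

theorem exists_mem_EK_from (v : Fin 4) : ∃ w, (v, (), w) ∈ EK := by
  fin_cases v <;> simp [EK]

theorem exists_mem_EK_to (v : Fin 4) : ∃ u, (u, (), v) ∈ EK := by
  fin_cases v <;> simp [EK]

theorem dualSim_EP_EK_univ : DualSim EP EK (Set.univ : Set (Fin 2 × Fin 4)) := by
  intro _ v₂ _
  refine ⟨fun _ _ _ => ?_, fun _ _ _ => ?_⟩
  · simpa using exists_mem_EK_from v₂
  · simpa using exists_mem_EK_to v₂

theorem ne_three_of_mem_EK_of_mem_EK {p q : Fin 4} (hpq : (p, (), q) ∈ EK)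
    (hqp : (q, (), p) ∈ EK) : p ≠ 3 := by
  rintro rfl
  simp only [EK, Set.mem_insert_iff, Set.mem_singleton_iff, Prod.mk.injEq] at hpq hqp
  omega

/-- The converse of BGP soundness fails: the full relation is a dual simulation
between `P` and `K` (hence `(x, p₄)` lies in the largest dual simulation), yet no
homomorphic match of `P` in `K` maps `x` or `y` to `p₄`. -/
theorem dualSim_not_complete :
    DualSim EP EK (Set.univ : Set (Fin 2 × Fin 4)) ∧
    (∀ Smax : Set (Fin 2 × Fin 4),
        DualSim EP EK Smax → (∀ S, DualSim EP EK S → S ⊆ Smax) →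
        ((0 : Fin 2), (3 : Fin 4)) ∈ Smax) ∧
    ¬ ∃ μ : Fin 2 → Fin 4,
        ((μ 0, (), μ 1) ∈ EK ∧ (μ 1, (), μ 0) ∈ EK) ∧ (μ 0 = 3 ∨ μ 1 = 3) := by
  refine ⟨dualSim_EP_EK_univ, fun Smax _ hmax => hmax _ dualSim_EP_EK_univ (Set.mem_univ _), ?_⟩
  rintro ⟨μ, ⟨h₀₁, h₁₀⟩, h₀ | h₁⟩
  · exact ne_three_of_mem_EK_of_mem_EK h₀₁ h₁₀ h₀
  · exact ne_three_of_mem_EK_of_mem_EK h₁₀ h₀₁ h₁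
end

section
/- Let G₁ = (V₁, E₁) and G₂ = (V₂, E₂) be edge-labeled directed graphs over the same alphabet Σ with V₁ and V₂ finite, let F be the refinement operator, and define the sequence S₀ = V₁ × V₂ and S_{n+1} = F(S_n). Then the sequence (S_n) is decreasing (S_{n+1} ⊆ S_n for all n), and for every n ≥ |V₁| · |V₂|, S_n equals the largest dual simulation between G₁ and G₂. -/
/-- The refinement operator: `refine E₁ E₂ S` is the set of pairs `(v₁, v₂)`
satisfying the two dual-simulation conditions relative to `S`. -/
def refine {V₁ V₂ L : Type*} (E₁ : Set (V₁ × L × V₁)) (E₂ : Set (V₂ × L × V₂))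
    (S : Set (V₁ × V₂)) : Set (V₁ × V₂) :=
  {p | (∀ a w₁, (p.1, a, w₁) ∈ E₁ → ∃ w₂, (p.2, a, w₂) ∈ E₂ ∧ (w₁, w₂) ∈ S) ∧
       (∀ a u₁, (u₁, a, p.1) ∈ E₁ → ∃ u₂, (u₂, a, p.2) ∈ E₂ ∧ (u₁, u₂) ∈ S)}

theorem refine_mono {V₁ V₂ L : Type*} (E₁ : Set (V₁ × L × V₁)) (E₂ : Set (V₂ × L × V₂)) :
    Monotone (refine E₁ E₂) := by
  rintro S T hST p ⟨hout, hin⟩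
  constructor
  · intro a w₁ h
    obtain ⟨w₂, hw, hS⟩ := hout a w₁ h
    exact ⟨w₂, hw, hST hS⟩
  · intro a u₁ h
    obtain ⟨u₂, hu, hS⟩ := hin a u₁ h
    exact ⟨u₂, hu, hST hS⟩

theorem dualSim_iff_subset_refine {V₁ V₂ L : Type*} {E₁ : Set (V₁ × L × V₁)}
    {E₂ : Set (V₂ × L × V₂)} {S : Set (V₁ × V₂)} :
    DualSim E₁ E₂ S ↔ S ⊆ refine E₁ E₂ S :=
  ⟨fun h p hp => h p.1 p.2 hp, fun h _ _ hp => h hp⟩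

theorem Monotone.antitone_iterate_univ {α : Type*} {f : Set α → Set α} (hf : Monotone f) :
    Antitone fun n => f^[n] Set.univ :=
  hf.antitone_iterate_of_map_le (Set.subset_univ _)

theorem Monotone.iterate_univ_fixed_or_ncard_add_le {α : Type*} [Finite α]
    {f : Set α → Set α} (hf : Monotone f) (n : ℕ) :
    f^[n + 1] Set.univ = f^[n] Set.univ ∨ (f^[n] Set.univ).ncard + n ≤ Nat.card α := by
  induction n with
  | zero => exact Or.inr (by simp [Set.ncard_univ])
  | succ n ih =>
    by_cases heq : f^[n + 1] Set.univ = f^[n] Set.univ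
    · left
      rw [Function.iterate_succ_apply' f (n + 1), heq, ← Function.iterate_succ_apply' f n, heq]
    · have hlt := Set.ncard_lt_ncard
        ((hf.antitone_iterate_univ n.le_succ).ssubset_of_ne heq) (Set.toFinite _)
      have := ih.resolve_left heq
      simp only [Nat.succ_eq_add_one] at hlt
      exact Or.inr (by omega)

theorem Monotone.iterate_univ_fixed_of_card_le {α : Type*} [Finite α]
    {f : Set α → Set α} (hf : Monotone f) {n : ℕ} (hn : Nat.card α ≤ n) :
    f^[n + 1] Set.univ = f^[n] Set.univ := by
  rcases hf.iterate_univ_fixed_or_ncard_add_le n with h | h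
  · exact h
  · have hempty : f^[n] Set.univ = ∅ := (Set.ncard_eq_zero (Set.toFinite _)).1 (by omega)
    have hle : f^[n + 1] Set.univ ⊆ f^[n] Set.univ := hf.antitone_iterate_univ n.le_succ
    rw [hempty] at hle ⊢
    exact Set.subset_empty_iff.1 hle

/-- On finite node sets, the decreasing iteration of the refinement operator starting
from the full relation stabilizes after at most `|V₁| · |V₂|` steps at the largest
dual simulation. -/
theorem refine_iterate_eq_largest_dualSim {V₁ V₂ L : Type*}
    [Fintype V₁] [Fintype V₂]
    (E₁ : Set (V₁ × L × V₁)) (E₂ : Set (V₂ × L × V₂))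
    (Smax : Set (V₁ × V₂)) (hS : DualSim E₁ E₂ Smax)
    (hmax : ∀ S, DualSim E₁ E₂ S → S ⊆ Smax) :
    (∀ n : ℕ, (refine E₁ E₂)^[n + 1] Set.univ ⊆ (refine E₁ E₂)^[n] Set.univ) ∧
    (∀ n : ℕ, Fintype.card V₁ * Fintype.card V₂ ≤ n →
      (refine E₁ E₂)^[n] Set.univ = Smax) := by
  have hmono := refine_mono E₁ E₂
  constructor
  · intro n
    exact hmono.antitone_iterate_univ n.le_succ
  · intro n hn
    apply Set.Subset.antisymm
    · apply hmax
      rw [dualSim_iff_subset_refine, ← Function.iterate_succ_apply' (refine E₁ E₂) n,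
        hmono.iterate_univ_fixed_of_card_le (by simpa using hn)]
    · clear hn
      induction n with
      | zero => exact Set.subset_univ _
      | succ n ih =>
        rw [Function.iterate_succ_apply']
        exact (dualSim_iff_subset_refine.1 hS).trans (hmono ih)
end
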